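/- A single phase-flip error has deterministic syndrome given by the support membership: for every ψ in the codespace C, every i ∈ Fin 7 and every j ∈ Fin 3, gX j (Z i ψ) = Z i ψ if i ∉ S_j, and gX j (Z i ψ) = −(Z i ψ) if i ∈ S_j. -/

import Mathlib

noncomputable section

abbrev V7 := Fin 7 → ZMod 2
abbrev H7 := V7 → ℂ

/-- The three Steane-code supports. -/
def S : Fin 3 → Finset (Fin 7)
  | 0 => {0, 4, 5, 6}
  | 1 => {1, 3, 5, 6}
  | 2 => {2, 3, 4, 6}

/-- Pauli X on qubit `i`: `X i (e_v) = e_{v'}` with `v' = v` except `v' i = v i + 1`. -/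
def Xop (i : Fin 7) : H7 →ₗ[ℂ] H7 where
  toFun ψ := fun v => ψ (v + Pi.single i 1)
  map_add' _ _ := rfl
  map_smul' _ _ := by funext v; simp

/-- Pauli Z on qubit `i`: `Z i (e_v) = (-1)^(v i) e_v`. -/
def Zop (i : Fin 7) : H7 →ₗ[ℂ] H7 where
  toFun ψ := fun v => (-1 : ℂ) ^ (v i).val * ψ v
  map_add' ψ φ := by funext v; simp [mul_add]
  map_smul' c ψ := by funext v; simp; ring

/-- Stabilizer generator `gX j = ∏_{i ∈ S j} X i` (the factors commute). -/
def gX (j : Fin 3) : H7 →ₗ[ℂ] H7 :=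
  (S j).noncommProd (fun i => Xop i) (fun a _ b _ _ => by
    apply LinearMap.ext; intro ψ; funext v
    exact congrArg ψ (add_right_comm v (Pi.single a 1) (Pi.single b 1)))

/-- Stabilizer generator `gZ j = ∏_{i ∈ S j} Z i` (the factors commute). -/
def gZ (j : Fin 3) : H7 →ₗ[ℂ] H7 :=
  (S j).noncommProd (fun i => Zop i) (fun a _ b _ _ => by
    apply LinearMap.ext; intro ψ; funext v
    show (-1:ℂ) ^ (v a).val * ((-1:ℂ) ^ (v b).val * ψ v)
       = (-1:ℂ) ^ (v b).val * ((-1:ℂ) ^ (v a).val * ψ v)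
    ring)

/-- Indicator vector of `S j`. -/
def r (j : Fin 3) : V7 := fun i => if i ∈ S j then 1 else 0

/-- The 𝔽₂-span of the three rows. -/
def Hcode : Submodule (ZMod 2) V7 := Submodule.span (ZMod 2) {r 0, r 1, r 2}

/-- Standard basis vector `e_v`. -/
def e (v : V7) : H7 := Pi.single v 1

/-- Logical codeword `u₀ = 8^{-1/2} ∑_{v ∈ H} e_v`. -/
def u0 : H7 := ((Real.sqrt 8 : ℂ))⁻¹ • ∑ᶠ v ∈ (Hcode : Set V7), e v

/-- Logical codeword `u₁ = 8^{-1/2} ∑_{v ∈ H} e_{v + 𝟙}`. -/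
def u1 : H7 := ((Real.sqrt 8 : ℂ))⁻¹ • ∑ᶠ v ∈ (Hcode : Set V7), e (v + 1)

/-- The codespace `C = Span_ℂ {u₀, u₁}`. -/
def Cspace : Submodule ℂ H7 := Submodule.span ℂ {u0, u1}


theorem Xop_noncommProd (s : Finset (Fin 7)) (h) (ψ : H7) (v : V7) :
    (s.noncommProd (fun i => Xop i) h) ψ v = ψ (v + ∑ i ∈ s, Pi.single i 1) := by
  induction s using Finset.induction_on generalizing v with
  | empty => simp
  | insert a s ha ih =>
    rw [Finset.noncommProd_insert_of_notMem _ _ _ _ ha, Finset.sum_insert ha, Module.End.mul_apply]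
    change (s.noncommProd (fun i => Xop i) _) ψ (v + Pi.single a 1) = _
    rw [ih, add_assoc]

theorem gX_apply (j : Fin 3) (ψ : H7) (v : V7) : gX j ψ v = ψ (v + r j) := by
  refine (Xop_noncommProd (S j) _ ψ v).trans ?_
  congr 2
  funext k
  simp [r, Finset.sum_apply, Pi.single_apply]

theorem r_mem (j : Fin 3) : r j ∈ Hcode := by
  apply Submodule.subset_span
  fin_cases j <;> simp

open Classical in
theorem sum_e_apply (c w : V7) :
    (∑ᶠ v ∈ (Hcode : Set V7), e (v + c)) w = if w - c ∈ Hcode then 1 else 0 := by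
  rw [finsum_mem_eq_finite_toFinset_sum _ (Set.toFinite _), Finset.sum_apply]
  have h : ∀ v : V7, e (v + c) w = if w - c = v then (1 : ℂ) else 0 := by
    intro v
    simp only [e, Pi.single_apply, sub_eq_iff_eq_add]
  simp only [h, Finset.sum_ite_eq, Set.Finite.mem_toFinset, SetLike.mem_coe]

theorem sum_e_inv (c w : V7) (j : Fin 3) :
    (∑ᶠ v ∈ (Hcode : Set V7), e (v + c)) (w + r j) = (∑ᶠ v ∈ (Hcode : Set V7), e (v + c)) w := by
  classical
  rw [sum_e_apply, sum_e_apply, add_sub_right_comm, Hcode.add_mem_iff_left (r_mem j)]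

theorem C_inv (ψ : H7) (hψ : ψ ∈ Cspace) (j : Fin 3) (w : V7) : ψ (w + r j) = ψ w := by
  unfold Cspace at hψ
  obtain ⟨a, b, rfl⟩ := Submodule.mem_span_pair.1 hψ
  have h0 := sum_e_inv 0 w j
  have h1 := sum_e_inv 1 w j
  simp only [add_zero] at h0
  simp only [u0, u1, Pi.add_apply, Pi.smul_apply, h0, h1]

theorem sign_flip (x : ZMod 2) : (-1 : ℂ) ^ (x + 1).val = -(-1 : ℂ) ^ x.val := by
  obtain rfl | rfl : x = 0 ∨ x = 1 := by revert x; decide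
  · simp [ZMod.val_one]
  · have : (1 + 1 : ZMod 2) = 0 := by decide
    simp [this, ZMod.val_one]

/-- A single phase-flip error has deterministic syndrome given by support
membership: for `ψ` in the codespace, `gX j (Z i ψ) = ± Z i ψ` according to
whether `i ∈ S j`. -/
theorem phaseflip_syndrome (ψ : H7) (hψ : ψ ∈ Cspace) (i : Fin 7) (j : Fin 3) :
    (i ∉ S j → gX j (Zop i ψ) = Zop i ψ) ∧
    (i ∈ S j → gX j (Zop i ψ) = -(Zop i ψ)) := by
  have key : ∀ v, gX j (Zop i ψ) v = (-1 : ℂ) ^ (v i + r j i).val * ψ v := by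
    intro v
    rw [gX_apply]
    change (-1 : ℂ) ^ ((v + r j) i).val * ψ (v + r j) = _
    rw [C_inv ψ hψ, Pi.add_apply]
  constructor
  · intro hi
    funext v
    rw [key]
    simp only [r, hi, if_false, add_zero]
    rfl
  · intro hi
    funext v
    rw [key]
    simp only [r, hi, if_true, sign_flip, neg_mul]
    rfl

end
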